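/- arXiv:1611.09744 — 2 statements merged into one kernel-verified Lean document; each statement's English description precedes it below -/
import Mathlib

section
/- For every α > 48 there are a constant c > 0 depending only on α and an absolute constant d0 ≥ 3 such that for all d ≥ d0, all σ > 0, and all integers s with 1 ≤ s ≤ √(d log d/2): sup_{θ ∈ Θ_s} E_θ[(L̂'_s(y) − L(θ))²] ≤ c·Φ^L(σ,s). -/
open MeasureTheory ProbabilityTheory

/-- Law of `y = θ + σ·ξ` with `ξ` i.i.d. standard normal: the product of Gaussians `N(θ j, σ²)`. -/
noncomputable def gaussMeasure (d : ℕ) (θ : Fin d → ℝ) (σ : ℝ) : Measure (Fin d → ℝ) :=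
  Measure.pi fun j => gaussianReal (θ j) (Real.toNNReal (σ ^ 2))

/-- The sparsity class `Θ_s`: vectors with at most `s` nonzero coordinates. -/
def Theta (d s : ℕ) : Set (Fin d → ℝ) := {θ | {j | θ j ≠ 0}.ncard ≤ s}

/-- The linear functional `L(θ) = ∑ θ_j`. -/
noncomputable def Lfun (d : ℕ) (θ : Fin d → ℝ) : ℝ := ∑ j, θ j

/-- The rate `Φ^L(σ, s) = σ² s² log(1 + d (log d) / s²)`. -/
noncomputable def PhiL (d : ℕ) (σ : ℝ) (s : ℕ) : ℝ :=
  σ ^ 2 * (s : ℝ) ^ 2 * Real.log (1 + (d : ℝ) * Real.log d / (s : ℝ) ^ 2)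

/-- The variance estimator `σ̂ = 9 (⌊d/2⌋⁻¹ ∑_{j ≤ d/2} y_(j)²)^{1/2}`, where the sum of the
`⌊d/2⌋` smallest among `y_1², …, y_d²` is expressed as the minimum over all subsets `G` of
cardinality `⌊d/2⌋` of `∑_{i ∈ G} y_i²`. -/
noncomputable def sigmahat (d : ℕ) (y : Fin d → ℝ) : ℝ :=
  9 * Real.sqrt (((d / 2 : ℕ) : ℝ)⁻¹ *
    sInf {x : ℝ | ∃ G : Finset (Fin d), G.card = d / 2 ∧ x = ∑ i ∈ G, (y i) ^ 2})

/-- The non-adaptive estimators `L̂'_s` (unknown `σ`, plug-in `σ̂`). -/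
noncomputable def LhatS' (d : ℕ) (α : ℝ) (s : ℕ) (y : Fin d → ℝ) : ℝ :=
  if (s : ℝ) ≤ Real.sqrt ((d : ℝ) * Real.log d / 2) then
    ∑ j, if α * (sigmahat d y) ^ 2 * Real.log (1 + (d : ℝ) * Real.log d / (s : ℝ) ^ 2) < (y j) ^ 2
      then y j else 0
  else ∑ j, y j

/-! ### Deterministic facts on the variance estimator -/

lemma aux_nonneg (d : ℕ) (y : Fin d → ℝ) :
    0 ≤ sInf {x : ℝ | ∃ G : Finset (Fin d), G.card = d / 2 ∧ x = ∑ i ∈ G, (y i) ^ 2} := by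
  apply Real.sInf_nonneg
  rintro x ⟨G, -, rfl⟩
  positivity

lemma sigmahat_sq (d : ℕ) (y : Fin d → ℝ) :
    sigmahat d y ^ 2 = 81 * (((d / 2 : ℕ) : ℝ)⁻¹ *
      sInf {x : ℝ | ∃ G : Finset (Fin d), G.card = d / 2 ∧ x = ∑ i ∈ G, (y i) ^ 2}) := by
  unfold sigmahat
  rw [mul_pow, Real.sq_sqrt (mul_nonneg (by positivity) (aux_nonneg d y))]
  norm_num

lemma sigmahat_sq_le (d : ℕ) (y : Fin d → ℝ) (G : Finset (Fin d)) (hG : G.card = d / 2) :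
    sigmahat d y ^ 2 ≤ 81 * (((d / 2 : ℕ) : ℝ)⁻¹ * ∑ i ∈ G, (y i) ^ 2) := by
  rw [sigmahat_sq]
  gcongr
  refine csInf_le ⟨0, ?_⟩ ⟨G, hG, rfl⟩
  rintro x ⟨G, -, rfl⟩
  positivity

lemma sigmahat_congr (d : ℕ) (y z : Fin d → ℝ) (h : ∀ i, y i ^ 2 = z i ^ 2) :
    sigmahat d y = sigmahat d z := by
  simp only [sigmahat, h]

lemma measurable_sigmahat (d : ℕ) : Measurable (sigmahat d) := by
  have h : ∀ y : Fin d → ℝ,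
      sInf {x : ℝ | ∃ G : Finset (Fin d), G.card = d / 2 ∧ x = ∑ i ∈ G, (y i) ^ 2}
      = ⨅ G : {G : Finset (Fin d) // G.card = d / 2}, ∑ i ∈ G.1, (y i) ^ 2 := by
    intro y
    rw [iInf]
    congr 1
    ext x
    constructor
    · rintro ⟨G, hG, rfl⟩
      exact ⟨⟨G, hG⟩, rfl⟩
    · rintro ⟨⟨G, hG⟩, rfl⟩
      exact ⟨G, hG, rfl⟩
  unfold sigmahat
  simp only [h]
  refine Measurable.const_mul (Measurable.sqrt (Measurable.const_mul ?_ _)) _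
  refine Measurable.iInf fun G => ?_
  fun_prop

/-- If few coordinates off `S` are small then `σ̂²` is bounded below. -/
lemma sigmahat_lower (d : ℕ) (y : Fin d → ℝ) (v : ℝ) (hv : 0 < v) (S : Finset (Fin d))
    (hd : 100 ≤ d) (hS : (S.card : ℝ) ≤ d / 10)
    (hN : ((Finset.univ.filter fun i => i ∉ S ∧ y i ^ 2 ≤ v / 144).card : ℝ) ≤ d / 4) :
    v / 12 ≤ sigmahat d y ^ 2 := by
  have hdR : (100 : ℝ) ≤ d := by exact_mod_cast hd
  have hm : ((d : ℝ) - 1) / 2 ≤ ((d / 2 : ℕ) : ℝ) := by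
    have : d ≤ 2 * (d / 2) + 1 := by omega
    have : (d : ℝ) ≤ 2 * ((d / 2 : ℕ) : ℝ) + 1 := by exact_mod_cast this
    linarith
  have hmpos : (0 : ℝ) < ((d / 2 : ℕ) : ℝ) := by linarith
  rw [sigmahat_sq]
  have key : v / 972 * ((d / 2 : ℕ) : ℝ) ≤
      sInf {x : ℝ | ∃ G : Finset (Fin d), G.card = d / 2 ∧ x = ∑ i ∈ G, (y i) ^ 2} := by
    apply le_csInf
    · obtain ⟨G, -, hG⟩ := Finset.exists_subset_card_eq (s := (Finset.univ : Finset (Fin d)))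
        (n := d / 2) (by simp; omega)
      exact ⟨_, G, hG, rfl⟩
    · rintro x ⟨G, hG, rfl⟩
      set N := Finset.univ.filter fun i => i ∉ S ∧ y i ^ 2 ≤ v / 144 with hNdef
      have h1 : G.card ≤ (G \ (S ∪ N)).card + (S.card + N.card) := by
        have := Finset.le_card_sdiff (S ∪ N) G
        have h2 := Finset.card_union_le S N
        omega
      have h1R : ((d / 2 : ℕ) : ℝ) ≤ ((G \ (S ∪ N)).card : ℝ) + (S.card + N.card) := by
        rw [← hG]; exact_mod_cast h1
      have h3 : ((G \ (S ∪ N)).card : ℝ) * (v / 144) ≤ ∑ i ∈ G \ (S ∪ N), y i ^ 2 := by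
        rw [← nsmul_eq_mul]
        apply Finset.card_nsmul_le_sum
        intro i hi
        simp only [hNdef, Finset.mem_sdiff, Finset.mem_union, Finset.mem_filter,
          Finset.mem_univ, true_and, not_or, not_and, not_le] at hi
        exact (hi.2.2 hi.2.1).le
      have h4 : ∑ i ∈ G \ (S ∪ N), y i ^ 2 ≤ ∑ i ∈ G, y i ^ 2 :=
        Finset.sum_le_sum_of_subset_of_nonneg Finset.sdiff_subset (fun _ _ _ => sq_nonneg _)
      refine le_trans ?_ (h3.trans h4)
      have h5 : ((d / 2 : ℕ) : ℝ) * (144 / 972) ≤ ((G \ (S ∪ N)).card : ℝ) := by linarith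
      nlinarith
  calc v / 12 = 81 * (((d / 2 : ℕ) : ℝ)⁻¹ * (v / 972 * ((d / 2 : ℕ) : ℝ))) := by
        field_simp; norm_num
    _ ≤ _ := by gcongr

/-! ### One dimensional Gaussian bounds -/

lemma gauss_sq (m : ℝ) (v : NNReal) : ∫ x, (x - m) ^ 2 ∂(gaussianReal m v) = v := by
  have h := variance_id_gaussianReal (μ := m) (v := v)
  rw [variance_eq_integral (by fun_prop)] at h
  simpa using h

lemma gauss_tail (v : NNReal) (hv : v ≠ 0) (t : ℝ) :
    ∫ x, (if t * v < x ^ 2 then x ^ 2 else 0) ∂(gaussianReal 0 v)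
      ≤ 16 * v * Real.exp (-t / 4) := by
  have hv0 : (0 : ℝ) < v := by positivity
  rw [integral_gaussianReal_eq_integral_smul hv]
  have hi : Integrable fun x : ℝ => (8 * v * Real.exp (-t / 4) * (√(2 * Real.pi * v))⁻¹) *
      Real.exp (-(1 / (8 * v)) * x ^ 2) :=
    (integrable_exp_neg_mul_sq (by positivity)).const_mul _
  refine (integral_mono_of_nonneg (ae_of_all _ fun x => ?_) hi (ae_of_all _ fun x => ?_)).trans ?_
  · have := gaussianPDFReal_nonneg 0 v x
    simp only [smul_eq_mul, Pi.zero_apply]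
    split_ifs <;> positivity
  · simp only [smul_eq_mul, gaussianPDFReal]
    split_ifs with h
    · have h1 : x ^ 2 ≤ 8 * v * Real.exp (x ^ 2 / (8 * v)) := by
        have := Real.add_one_le_exp (x ^ 2 / (8 * v))
        calc x ^ 2 = 8 * v * (x ^ 2 / (8 * v)) := by field_simp
          _ ≤ _ := by gcongr; linarith
      have h2 : Real.exp (-x ^ 2 / (2 * v)) * Real.exp (x ^ 2 / (8 * v)) ≤
          Real.exp (-t / 4) * Real.exp (-(1 / (8 * v)) * x ^ 2) := by
        rw [← Real.exp_add, ← Real.exp_add, Real.exp_le_exp]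
        have : t < x ^ 2 / v := by rwa [lt_div_iff₀ hv0]
        have e1 : -x ^ 2 / (2 * v) = - (x ^ 2 / v) / 2 := by field_simp
        have e2 : x ^ 2 / (8 * v) = (x ^ 2 / v) / 8 := by field_simp
        have e3 : -(1 / (8 * v)) * x ^ 2 = - (x ^ 2 / v) / 8 := by field_simp
        rw [e1, e2, e3]
        linarith
      calc (√(2 * Real.pi * v))⁻¹ * Real.exp (-(x - 0) ^ 2 / (2 * v)) * x ^ 2
          ≤ (√(2 * Real.pi * v))⁻¹ * Real.exp (-(x - 0) ^ 2 / (2 * v)) *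
            (8 * v * Real.exp (x ^ 2 / (8 * v))) := by gcongr
        _ = (8 * v) * (√(2 * Real.pi * v))⁻¹ *
            (Real.exp (-x ^ 2 / (2 * v)) * Real.exp (x ^ 2 / (8 * v))) := by
            rw [sub_zero]; ring
        _ ≤ (8 * v) * (√(2 * Real.pi * v))⁻¹ *
            (Real.exp (-t / 4) * Real.exp (-(1 / (8 * v)) * x ^ 2)) := by gcongr
        _ = _ := by ring
    · rw [mul_zero]; positivity
  · rw [integral_const_mul, integral_gaussian]
    have : √(Real.pi / (1 / (8 * v))) = 2 * √(2 * Real.pi * v) := by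
      have : Real.pi / (1 / (8 * (v : ℝ))) = 2 ^ 2 * (2 * Real.pi * v) := by field_simp; ring
      rw [this, Real.sqrt_mul (by positivity), Real.sqrt_sq (by norm_num)]
    rw [this]
    have : √(2 * Real.pi * v) ≠ 0 := by positivity
    apply le_of_eq
    field_simp
    norm_num

/-- The weight counting small coordinates. -/
noncomputable def wgt (v x : ℝ) : ℝ := if x ^ 2 ≤ v / 144 then Real.exp 1 else 1

lemma measurable_wgt (v : ℝ) : Measurable (wgt v) := by
  unfold wgt
  exact Measurable.ite (measurableSet_le (by fun_prop) (by fun_prop)) (by fun_prop) (by fun_prop)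

lemma wgt_one_le (v x : ℝ) : 1 ≤ wgt v x := by
  unfold wgt
  split_ifs
  · exact Real.one_le_exp (by norm_num)
  · exact le_rfl

lemma wgt_le (v x : ℝ) : wgt v x ≤ Real.exp 1 := by
  unfold wgt
  split_ifs
  · exact le_rfl
  · exact Real.one_le_exp (by norm_num)

lemma gauss_small (v : NNReal) (hv : v ≠ 0) :
    (gaussianReal 0 v).real {x | x ^ 2 ≤ (v : ℝ) / 144} ≤ 1 / 12 := by
  have hv0 : (0 : ℝ) < v := by positivity
  have hset : {x : ℝ | x ^ 2 ≤ (v : ℝ) / 144} = Set.Icc (-(√v / 12)) (√v / 12) := by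
    ext x
    rw [Set.mem_ofPred_eq, Set.mem_Icc, ← abs_le]
    rw [← abs_of_pos (show 0 < √(v : ℝ) / 12 by positivity), ← sq_le_sq, div_pow,
      Real.sq_sqrt hv0.le]
    norm_num
  rw [hset, measureReal_def, gaussianReal_apply_eq_integral _ hv,
    ENNReal.toReal_ofReal (integral_nonneg fun x => gaussianPDFReal_nonneg 0 v x)]
  have hpi : 2 * √(v : ℝ) ≤ √(2 * Real.pi * v) := by
    apply Real.le_sqrt_of_sq_le
    rw [mul_pow, Real.sq_sqrt hv0.le]
    nlinarith [Real.pi_gt_three]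
  have hsv : 0 < √(v : ℝ) := by positivity
  calc ∫ x in Set.Icc (-(√v / 12)) (√v / 12), gaussianPDFReal 0 v x
      ≤ ∫ x in Set.Icc (-(√(v : ℝ) / 12)) (√v / 12), (2 * √(v : ℝ))⁻¹ := by
        apply setIntegral_mono
        · exact (integrable_gaussianPDFReal 0 v).integrableOn
        · exact continuous_const.integrableOn_Icc
        · intro x
          simp only [gaussianPDFReal]
          calc (√(2 * Real.pi * v))⁻¹ * Real.exp (-(x - 0) ^ 2 / (2 * v))
              ≤ (2 * √(v : ℝ))⁻¹ * 1 := by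
                gcongr
                rw [Real.exp_le_one_iff]
                apply div_nonpos_of_nonpos_of_nonneg
                · nlinarith [sq_nonneg (x - 0)]
                · positivity
            _ = _ := mul_one _
    _ = 1 / 12 := by
        rw [setIntegral_const]
        simp only [measureReal_def, Real.volume_Icc, smul_eq_mul]
        rw [ENNReal.toReal_ofReal (by linarith)]
        field_simp
        norm_num

lemma gauss_wgt (v : NNReal) (hv : v ≠ 0) :
    ∫ x, wgt v x ∂(gaussianReal 0 v) ≤ Real.exp (3 / 20) := by
  have hms : MeasurableSet {x : ℝ | x ^ 2 ≤ (v : ℝ) / 144} :=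
    measurableSet_le (by fun_prop) (by fun_prop)
  have h1 : ∀ x, wgt v x = 1 +
      Set.indicator {x : ℝ | x ^ 2 ≤ (v : ℝ) / 144} (fun _ => Real.exp 1 - 1) x := by
    intro x
    by_cases h : x ^ 2 ≤ (v : ℝ) / 144 <;> simp [wgt, Set.indicator, h]
  simp only [h1]
  rw [integral_add (integrable_const _) ((integrable_const _).indicator hms),
    integral_indicator_const _ hms]
  simp only [integral_const, probReal_univ, smul_eq_mul]
  have h2 := gauss_small v hv
  have h3 := Real.exp_one_lt_d9
  have h4 := Real.add_one_le_exp (3 / 20 : ℝ)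
  have h5 := Real.exp_one_gt_d9
  nlinarith [mul_le_mul_of_nonneg_right h2 (show 0 ≤ Real.exp 1 - 1 by linarith)]

/-! ### The product measure -/

instance gaussMeasure_prob (d : ℕ) (θ : Fin d → ℝ) (σ : ℝ) :
    IsProbabilityMeasure (gaussMeasure d θ σ) := by
  unfold gaussMeasure; infer_instance

lemma memLp_coord (d : ℕ) (θ : Fin d → ℝ) (σ : ℝ) (j : Fin d) :
    MemLp (fun y : Fin d → ℝ => y j) 2 (gaussMeasure d θ σ) :=
  (memLp_id_gaussianReal 2).comp_measurePreserving
    (measurePreserving_eval (fun j => gaussianReal (θ j) (Real.toNNReal (σ ^ 2))) j)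

lemma integral_coord_sq (d : ℕ) (θ : Fin d → ℝ) (σ : ℝ) (j : Fin d) :
    ∫ y, (y j - θ j) ^ 2 ∂(gaussMeasure d θ σ) = σ ^ 2 := by
  unfold gaussMeasure
  rw [integral_comp_eval (μ := fun j => gaussianReal (θ j) (Real.toNNReal (σ ^ 2))) (i := j)
    (f := fun x : ℝ => (x - θ j) ^ 2) (by fun_prop), gauss_sq, Real.coe_toNNReal _ (sq_nonneg σ)]

lemma integrable_coord_sq (d : ℕ) (θ : Fin d → ℝ) (σ : ℝ) (j : Fin d) (a : ℝ) :
    Integrable (fun y : Fin d → ℝ => (y j - a) ^ 2) (gaussMeasure d θ σ) :=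
  ((memLp_coord d θ σ j).sub (memLp_const a)).integrable_sq

/-- The thresholded coordinate. -/
noncomputable def trunc (d : ℕ) (α l : ℝ) (j : Fin d) (y : Fin d → ℝ) : ℝ :=
  if α * (sigmahat d y) ^ 2 * l < (y j) ^ 2 then y j else 0

lemma measurable_trunc (d : ℕ) (α l : ℝ) (j : Fin d) : Measurable (trunc d α l j) := by
  unfold trunc
  have := measurable_sigmahat d
  exact Measurable.ite (measurableSet_lt (by fun_prop) (by fun_prop)) (by fun_prop) (by fun_prop)

lemma memLp_trunc (d : ℕ) (θ : Fin d → ℝ) (σ α l : ℝ) (j : Fin d) :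
    MemLp (trunc d α l j) 2 (gaussMeasure d θ σ) := by
  refine (memLp_coord d θ σ j).mono (measurable_trunc d α l j).aestronglyMeasurable
    (ae_of_all _ fun y => ?_)
  unfold trunc
  split_ifs <;> simp

/-- Cross terms vanish by symmetry. -/
lemma integral_cross (d : ℕ) (θ : Fin d → ℝ) (σ α l : ℝ) (i j : Fin d) (hij : i ≠ j)
    (hi : θ i = 0) :
    ∫ y, trunc d α l i y * trunc d α l j y ∂(gaussMeasure d θ σ) = 0 := by
  set F : (Fin d → ℝ) → (Fin d → ℝ) := fun y k => if k = i then - y k else y k with hF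
  have hmp : MeasurePreserving F (gaussMeasure d θ σ) (gaussMeasure d θ σ) := by
    unfold gaussMeasure
    refine measurePreserving_pi (f := fun k x => if k = i then - x else x) _ _ fun k => ?_
    by_cases hk : k = i
    · subst hk
      simp only [if_true]
      refine ⟨measurable_neg, ?_⟩
      have := gaussianReal_map_neg (μ := θ k) (v := Real.toNNReal (σ ^ 2))
      rw [hi, neg_zero] at this
      rw [hi]
      exact this
    · simp only [hk, if_false]
      exact MeasurePreserving.id _
  have hsq : ∀ y k, F y k ^ 2 = y k ^ 2 := by
    intro y k
    simp only [hF]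
    split_ifs <;> ring
  have hs : ∀ y, sigmahat d (F y) = sigmahat d y := fun y => sigmahat_congr d _ _ (hsq y)
  have h1 : ∀ y, trunc d α l i (F y) = - trunc d α l i y := by
    intro y
    unfold trunc
    rw [hs, hsq]
    split_ifs <;> simp [hF]
  have h2 : ∀ y, trunc d α l j (F y) = trunc d α l j y := by
    intro y
    unfold trunc
    rw [hs, hsq]
    split_ifs <;> simp [hF, hij.symm]
  have hm : Measurable fun y => trunc d α l i y * trunc d α l j y :=
    (measurable_trunc d α l i).mul (measurable_trunc d α l j)
  have h3 : ∫ y, trunc d α l i y * trunc d α l j y ∂(gaussMeasure d θ σ)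
      = ∫ y, trunc d α l i (F y) * trunc d α l j (F y) ∂(gaussMeasure d θ σ) := by
    conv_lhs => rw [← hmp.map_eq]
    rw [integral_map hmp.measurable.aemeasurable hm.aestronglyMeasurable]
  simp only [h1, h2, neg_mul, integral_neg] at h3
  linarith

/-- The product weight used to control the bad event. -/
noncomputable def hfac (d : ℕ) (v : ℝ) (S : Finset (Fin d)) (j i : Fin d) (x : ℝ) : ℝ :=
  (if i = j then x ^ 2 else 1) * (if i ∈ S then 1 else wgt v x)

lemma hfac_nonneg (d : ℕ) (v : ℝ) (S : Finset (Fin d)) (j i : Fin d) (x : ℝ) :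
    0 ≤ hfac d v S j i x := by
  have := wgt_one_le v x
  unfold hfac
  split_ifs <;> positivity

lemma prod_hfac (d : ℕ) (v : ℝ) (S : Finset (Fin d)) (j : Fin d) (y : Fin d → ℝ) :
    ∏ i, hfac d v S j i (y i) = y j ^ 2 *
      Real.exp ((Finset.univ.filter fun i => i ∉ S ∧ y i ^ 2 ≤ v / 144).card : ℝ) := by
  unfold hfac
  rw [Finset.prod_mul_distrib, Finset.prod_ite_eq' Finset.univ j (fun i => y i ^ 2)]
  simp only [Finset.mem_univ, if_true]
  congr 1
  have : ∀ i, (if i ∈ S then 1 else wgt v (y i)) =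
      if i ∉ S ∧ y i ^ 2 ≤ v / 144 then Real.exp 1 else 1 := by
    intro i
    by_cases h1 : i ∈ S <;> simp [h1, wgt]
  simp only [this]
  rw [← Finset.prod_filter, Finset.prod_const, ← Real.exp_nat_mul, mul_one]

lemma integrable_hfac (d : ℕ) (v : ℝ) (S : Finset (Fin d)) (j i : Fin d) (m : ℝ) (w : NNReal) :
    Integrable (hfac d v S j i) (gaussianReal m w) := by
  have h1 : Integrable (fun x : ℝ => if i = j then x ^ 2 else 1) (gaussianReal m w) := by
    split_ifs
    · exact (memLp_id_gaussianReal 2).integrable_sq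
    · exact integrable_const _
  refine h1.mul_bdd (c := Real.exp 1) ?_ (ae_of_all _ fun x => ?_)
  · have := measurable_wgt v
    split_ifs
    · fun_prop
    · exact this.aestronglyMeasurable
  · have h1 := wgt_one_le v x
    have h2 := wgt_le v x
    rw [Real.norm_eq_abs]
    split_ifs
    · rw [abs_one]; linarith
    · rw [abs_of_nonneg (by linarith)]; exact h2

lemma integral_hfac_prod (d : ℕ) (θ : Fin d → ℝ) (σ : ℝ) (hσ : 0 < σ) (S : Finset (Fin d))
    (hS : ∀ i, i ∉ S → θ i = 0) (j : Fin d) (hj : j ∉ S) :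
    ∫ y, ∏ i, hfac d (σ ^ 2) S j i (y i) ∂(gaussMeasure d θ σ)
      ≤ Real.exp 1 * σ ^ 2 * Real.exp (3 / 20 * d) := by
  unfold gaussMeasure
  rw [integral_fintype_prod_eq_prod]
  have hv : Real.toNNReal (σ ^ 2) ≠ 0 := by
    simp only [ne_eq, Real.toNNReal_eq_zero, not_le]; positivity
  have hvc : ((Real.toNNReal (σ ^ 2) : NNReal) : ℝ) = σ ^ 2 := Real.coe_toNNReal _ (sq_nonneg σ)
  calc ∏ i, ∫ x, hfac d (σ ^ 2) S j i x ∂(gaussianReal (θ i) (Real.toNNReal (σ ^ 2)))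
      ≤ ∏ i, ((if i = j then Real.exp 1 * σ ^ 2 else 1) * Real.exp (3 / 20)) := by
        refine Finset.prod_le_prod (fun i _ => integral_nonneg fun x => hfac_nonneg _ _ _ _ _ _)
          fun i _ => ?_
        by_cases hij : i = j
        · subst hij
          simp only [if_true]
          have h0 := gauss_sq 0 (Real.toNNReal (σ ^ 2))
          simp only [sub_zero, hvc] at h0
          have h1 : ∫ x, hfac d (σ ^ 2) S i i x ∂(gaussianReal (θ i) (Real.toNNReal (σ ^ 2)))
              ≤ ∫ x, Real.exp 1 * x ^ 2 ∂(gaussianReal (θ i) (Real.toNNReal (σ ^ 2))) := by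
            refine integral_mono (integrable_hfac _ _ _ _ _ _ _)
              ((memLp_id_gaussianReal 2).integrable_sq.const_mul _) fun x => ?_
            simp only [hfac, if_true, hj, if_false]
            rw [mul_comm]
            exact mul_le_mul_of_nonneg_right (wgt_le _ _) (sq_nonneg x)
          rw [integral_const_mul, hS i hj, h0] at h1
          rw [hS i hj]
          refine h1.trans (le_mul_of_one_le_right (by positivity) (Real.one_le_exp (by norm_num)))
        · simp only [hij, if_false, one_mul, hfac]
          by_cases hi : i ∈ S
          · simp only [hi, if_true, integral_const, probReal_univ, smul_eq_mul, mul_one]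
            exact Real.one_le_exp (by norm_num)
          · simp only [hi, if_false, hS i hi]
            have := gauss_wgt _ hv
            rwa [hvc] at this
    _ = _ := by
        rw [Finset.prod_mul_distrib, Finset.prod_ite_eq' Finset.univ j
          (fun _ => Real.exp 1 * σ ^ 2)]
        simp only [Finset.mem_univ, if_true, Finset.prod_const, Finset.card_univ,
          Fintype.card_fin]
        rw [← Real.exp_nat_mul, mul_comm (d : ℝ)]

lemma integral_trunc_sq (d : ℕ) (θ : Fin d → ℝ) (σ α l : ℝ) (hσ : 0 < σ) (hα : 48 < α)
    (hl : 0 ≤ l) (S : Finset (Fin d)) (hd : 100 ≤ d) (hSc : (S.card : ℝ) ≤ d / 10)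
    (hS : ∀ i, i ∉ S → θ i = 0) (j : Fin d) (hj : j ∉ S) :
    ∫ y, trunc d α l j y * trunc d α l j y ∂(gaussMeasure d θ σ)
      ≤ σ ^ 2 * (16 * Real.exp (-l) + Real.exp 1 * Real.exp (-(d : ℝ) / 10)) := by
  have hv : Real.toNNReal (σ ^ 2) ≠ 0 := by
    simp only [ne_eq, Real.toNNReal_eq_zero, not_le]; positivity
  have hvc : ((Real.toNNReal (σ ^ 2) : NNReal) : ℝ) = σ ^ 2 := Real.coe_toNNReal _ (sq_nonneg σ)
  have hσ2 : 0 < σ ^ 2 := by positivity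
  set f : ℝ → ℝ := fun x => if 4 * l * σ ^ 2 < x ^ 2 then x ^ 2 else 0 with hf
  have hfm : Measurable f :=
    Measurable.ite (measurableSet_lt (by fun_prop) (by fun_prop)) (by fun_prop) (by fun_prop)
  have hfi : Integrable (fun y : Fin d → ℝ => f (y j)) (gaussMeasure d θ σ) := by
    refine (memLp_coord d θ σ j).integrable_sq.mono
      (hfm.comp (measurable_pi_apply j)).aestronglyMeasurable (ae_of_all _ fun y => ?_)
    simp only [hf]
    split_ifs
    · exact le_rfl
    · simp only [norm_zero]
      positivity
  have hpi : Integrable (fun y : Fin d → ℝ => Real.exp (-(d : ℝ) / 4) *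
      ∏ i, hfac d (σ ^ 2) S j i (y i)) (gaussMeasure d θ σ) :=
    (Integrable.fintype_prod fun i => integrable_hfac _ _ _ _ _ _ _).const_mul _
  have hpt : ∀ y : Fin d → ℝ, trunc d α l j y * trunc d α l j y ≤
      f (y j) + Real.exp (-(d : ℝ) / 4) * ∏ i, hfac d (σ ^ 2) S j i (y i) := by
    intro y
    have hf0 : 0 ≤ f (y j) := by simp only [hf]; split_ifs <;> positivity
    have hp0 : 0 ≤ Real.exp (-(d : ℝ) / 4) * ∏ i, hfac d (σ ^ 2) S j i (y i) :=
      mul_nonneg (Real.exp_pos _).le (Finset.prod_nonneg fun i _ => hfac_nonneg _ _ _ _ _ _)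
    by_cases hT : α * (sigmahat d y) ^ 2 * l < (y j) ^ 2
    · simp only [trunc, hT, if_true]
      by_cases hN : ((Finset.univ.filter fun i => i ∉ S ∧ y i ^ 2 ≤ σ ^ 2 / 144).card : ℝ) ≤ d / 4
      · have h1 := sigmahat_lower d y (σ ^ 2) hσ2 S hd hSc hN
        have h2 : 4 * σ ^ 2 ≤ α * sigmahat d y ^ 2 := by nlinarith
        have h3 : 4 * l * σ ^ 2 < y j ^ 2 := by
          have := mul_le_mul_of_nonneg_right h2 hl
          linarith
        have : f (y j) = y j ^ 2 := by simp only [hf, h3, if_true]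
        rw [this]
        nlinarith
      · rw [not_le] at hN
        rw [prod_hfac] at hp0 ⊢
        have : 1 ≤ Real.exp (-(d : ℝ) / 4) * Real.exp
            ((Finset.univ.filter fun i => i ∉ S ∧ y i ^ 2 ≤ σ ^ 2 / 144).card : ℝ) := by
          rw [← Real.exp_add]
          apply Real.one_le_exp
          linarith
        nlinarith [mul_le_mul_of_nonneg_left this (sq_nonneg (y j))]
    · simp only [trunc, hT, if_false, mul_zero]
      positivity
  refine (integral_mono ((memLp_trunc d θ σ α l j).integrable_mul (memLp_trunc d θ σ α l j))
    (hfi.add hpi) hpt).trans ?_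
  simp only [Pi.add_apply]
  rw [integral_add hfi hpi, integral_const_mul]
  have e1 : ∫ y, f (y j) ∂(gaussMeasure d θ σ) ≤ 16 * σ ^ 2 * Real.exp (-l) := by
    unfold gaussMeasure
    rw [integral_comp_eval (μ := fun j => gaussianReal (θ j) (Real.toNNReal (σ ^ 2))) (i := j)
      (f := f) hfm.aestronglyMeasurable, hS j hj]
    have := gauss_tail _ hv (4 * l)
    rw [hvc] at this
    refine this.trans (le_of_eq ?_)
    congr 2
    ring
  have e2 := mul_le_mul_of_nonneg_left (integral_hfac_prod d θ σ hσ S hS j hj)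
    (Real.exp_pos (-(d : ℝ) / 4)).le
  have e3 : Real.exp (-(d : ℝ) / 4) * (Real.exp 1 * σ ^ 2 * Real.exp (3 / 20 * d)) =
      σ ^ 2 * (Real.exp 1 * Real.exp (-(d : ℝ) / 10)) := by
    have : Real.exp (-(d : ℝ) / 10) = Real.exp (-(d : ℝ) / 4) * Real.exp (3 / 20 * d) := by
      rw [← Real.exp_add]; congr 1; ring
    rw [this]; ring
  rw [e3] at e2
  linarith

lemma integral_B (d : ℕ) (θ : Fin d → ℝ) (σ α l : ℝ) (hσ : 0 < σ) (hα : 48 < α)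
    (hl : 0 ≤ l) (S : Finset (Fin d)) (hd : 100 ≤ d) (hSc : (S.card : ℝ) ≤ d / 10)
    (hS : ∀ i, i ∉ S → θ i = 0) :
    ∫ y, (∑ j ∈ Sᶜ, trunc d α l j y) ^ 2 ∂(gaussMeasure d θ σ)
      ≤ d * (σ ^ 2 * (16 * Real.exp (-l) + Real.exp 1 * Real.exp (-(d : ℝ) / 10))) := by
  have hint : ∀ i j, Integrable (fun y => trunc d α l i y * trunc d α l j y)
      (gaussMeasure d θ σ) := fun i j =>
    (memLp_trunc d θ σ α l i).integrable_mul (memLp_trunc d θ σ α l j)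
  simp only [sq (∑ j ∈ Sᶜ, trunc d α l j _), Finset.sum_mul_sum]
  rw [integral_finsetSum _ fun i _ => integrable_finsetSum _ fun j _ => hint i j]
  have h1 : ∀ i ∈ Sᶜ, ∫ y, ∑ j ∈ Sᶜ, trunc d α l i y * trunc d α l j y ∂(gaussMeasure d θ σ)
      ≤ σ ^ 2 * (16 * Real.exp (-l) + Real.exp 1 * Real.exp (-(d : ℝ) / 10)) := by
    intro i hi
    rw [integral_finsetSum _ fun j _ => hint i j, Finset.sum_eq_single_of_mem i hi]
    · exact integral_trunc_sq d θ σ α l hσ hα hl S hd hSc hS i (by simpa using hi)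
    · intro j _ hji
      exact integral_cross d θ σ α l i j hji.symm (hS i (by simpa using hi))
  refine (Finset.sum_le_card_nsmul _ _ _ h1).trans ?_
  rw [nsmul_eq_mul]
  refine mul_le_mul_of_nonneg_right ?_ (by positivity)
  exact_mod_cast (Finset.card_le_univ _).trans (by simp)

/-- Pointwise bound for one coordinate in the support. -/
lemma trunc_sub_sq (d : ℕ) (α l : ℝ) (hα : 0 ≤ α) (hl : 0 ≤ l) (j : Fin d) (y : Fin d → ℝ)
    (a : ℝ) :
    (trunc d α l j y - a) ^ 2 ≤ 2 * (y j - a) ^ 2 + 2 * (α * sigmahat d y ^ 2 * l) := by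
  have h0 : 0 ≤ α * sigmahat d y ^ 2 * l := by positivity
  unfold trunc
  split_ifs with h
  · nlinarith [sq_nonneg (y j - a)]
  · rw [not_lt] at h
    nlinarith [sq_nonneg (2 * y j - a)]

lemma main_bound (d : ℕ) (θ : Fin d → ℝ) (σ α l : ℝ) (s : ℕ) (hσ : 0 < σ) (hα : 48 < α)
    (hl : 0 ≤ l) (S : Finset (Fin d)) (hd : 100 ≤ d) (hs : S.card ≤ s)
    (hSc : (S.card : ℝ) ≤ d / 10) (hS : ∀ i, i ∉ S → θ i = 0) :
    ∫⁻ y, ENNReal.ofReal ((∑ j, trunc d α l j y - Lfun d θ) ^ 2) ∂(gaussMeasure d θ σ)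
      ≤ ENNReal.ofReal (2 * (s ^ 2 * (2 * σ ^ 2 + 162 * α * l * σ ^ 2)) +
        2 * (d * (σ ^ 2 * (16 * Real.exp (-l) + Real.exp 1 * Real.exp (-(d : ℝ) / 10))))) := by
  have hα0 : 0 ≤ α := by linarith
  have hm0 : 0 < d / 2 := by omega
  have hmR : (0 : ℝ) < ((d / 2 : ℕ) : ℝ) := by exact_mod_cast hm0
  obtain ⟨G, hGS, hG⟩ := Finset.exists_subset_card_eq (s := Sᶜ) (n := d / 2) (by
    rw [Finset.card_compl, Fintype.card_fin]
    have : (10 * S.card : ℝ) ≤ d := by linarith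
    have : 10 * S.card ≤ d := by exact_mod_cast this
    omega)
  -- the dominating function
  set Q : (Fin d → ℝ) → ℝ := fun y => 81 * (((d / 2 : ℕ) : ℝ)⁻¹ * ∑ i ∈ G, (y i - θ i) ^ 2) with hQ
  set A : (Fin d → ℝ) → ℝ := fun y =>
    s * ∑ j ∈ S, (2 * (y j - θ j) ^ 2 + 2 * α * l * Q y) with hA
  set B : (Fin d → ℝ) → ℝ := fun y => (∑ j ∈ Sᶜ, trunc d α l j y) ^ 2 with hB
  have hQi : Integrable Q (gaussMeasure d θ σ) :=
    ((integrable_finsetSum _ fun i _ => integrable_coord_sq d θ σ i (θ i)).const_mul _).const_mul _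
  have hAterm : ∀ j, Integrable (fun y : Fin d → ℝ => 2 * (y j - θ j) ^ 2 + 2 * α * l * Q y)
      (gaussMeasure d θ σ) := fun j =>
    ((integrable_coord_sq d θ σ j (θ j)).const_mul _).add (hQi.const_mul _)
  have hAi : Integrable A (gaussMeasure d θ σ) :=
    (integrable_finsetSum _ fun j _ => hAterm j).const_mul _
  have hBi : Integrable B (gaussMeasure d θ σ) :=
    (memLp_finsetSum _ fun j _ => memLp_trunc d θ σ α l j).integrable_sq
  have hQint : ∫ y, Q y ∂(gaussMeasure d θ σ) = 81 * σ ^ 2 := by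
    simp only [hQ]
    rw [integral_const_mul, integral_const_mul,
      integral_finsetSum _ fun i _ => integrable_coord_sq d θ σ i (θ i)]
    simp only [integral_coord_sq, Finset.sum_const, hG, nsmul_eq_mul]
    field_simp
  have hQ0 : ∀ y, sigmahat d y ^ 2 ≤ Q y := by
    intro y
    refine (sigmahat_sq_le d y G hG).trans (le_of_eq ?_)
    simp only [hQ]
    congr 2
    refine Finset.sum_congr rfl fun i hi => ?_
    rw [hS i (by simpa using hGS hi), sub_zero]
  have hAint : ∫ y, A y ∂(gaussMeasure d θ σ) ≤
      s ^ 2 * (2 * σ ^ 2 + 162 * α * l * σ ^ 2) := by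
    simp only [hA]
    rw [integral_const_mul, integral_finsetSum _ fun j _ => hAterm j]
    have : ∀ j, ∫ y, (2 * (y j - θ j) ^ 2 + 2 * α * l * Q y) ∂(gaussMeasure d θ σ) =
        2 * σ ^ 2 + 162 * α * l * σ ^ 2 := by
      intro j
      rw [integral_add ((integrable_coord_sq d θ σ j (θ j)).const_mul _) (hQi.const_mul _),
        integral_const_mul, integral_const_mul, integral_coord_sq, hQint]
      ring
    simp only [this, Finset.sum_const, nsmul_eq_mul]
    rw [sq (s : ℝ), mul_assoc (s : ℝ) (s : ℝ)]
    gcongr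
  have hBint := integral_B d θ σ α l hσ hα hl S hd hSc hS
  have hpt : ∀ y, (∑ j, trunc d α l j y - Lfun d θ) ^ 2 ≤ 2 * A y + 2 * B y := by
    intro y
    have h1 : ∑ j, trunc d α l j y - Lfun d θ =
        ∑ j ∈ S, (trunc d α l j y - θ j) + ∑ j ∈ Sᶜ, trunc d α l j y := by
      unfold Lfun
      rw [← Finset.sum_sub_distrib, ← Finset.sum_add_sum_compl S]
      congr 1
      refine Finset.sum_congr rfl fun i hi => ?_
      rw [hS i (by simpa using hi), sub_zero]
    have h2 : (∑ j ∈ S, (trunc d α l j y - θ j)) ^ 2 ≤ A y := by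
      refine sq_sum_le_card_mul_sum_sq.trans ?_
      simp only [hA]
      have : ∀ j ∈ S, (trunc d α l j y - θ j) ^ 2 ≤ 2 * (y j - θ j) ^ 2 + 2 * α * l * Q y := by
        intro j _
        refine (trunc_sub_sq d α l hα0 hl j y (θ j)).trans ?_
        have := mul_le_mul_of_nonneg_left (hQ0 y) (show 0 ≤ 2 * α * l by positivity)
        linarith
      refine mul_le_mul (by exact_mod_cast hs) (Finset.sum_le_sum this)
        (Finset.sum_nonneg fun _ _ => sq_nonneg _) (by positivity)
    rw [h1]
    have h3 : B y = (∑ j ∈ Sᶜ, trunc d α l j y) ^ 2 := rfl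
    rw [h3]
    nlinarith [sq_nonneg (∑ j ∈ S, (trunc d α l j y - θ j) - ∑ j ∈ Sᶜ, trunc d α l j y)]
  have hHi : Integrable (fun y => 2 * A y + 2 * B y) (gaussMeasure d θ σ) :=
    (hAi.const_mul _).add (hBi.const_mul _)
  calc ∫⁻ y, ENNReal.ofReal ((∑ j, trunc d α l j y - Lfun d θ) ^ 2) ∂(gaussMeasure d θ σ)
      ≤ ∫⁻ y, ENNReal.ofReal (2 * A y + 2 * B y) ∂(gaussMeasure d θ σ) :=
        lintegral_mono fun y => ENNReal.ofReal_le_ofReal (hpt y)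
    _ = ENNReal.ofReal (∫ y, (2 * A y + 2 * B y) ∂(gaussMeasure d θ σ)) :=
        (ofReal_integral_eq_lintegral_ofReal hHi
          (ae_of_all _ fun y => (sq_nonneg _).trans (hpt y))).symm
    _ ≤ _ := by
        apply ENNReal.ofReal_le_ofReal
        rw [integral_add (hAi.const_mul _) (hBi.const_mul _), integral_const_mul (2 : ℝ) A,
          integral_const_mul (2 : ℝ) B]
        exact add_le_add (mul_le_mul_of_nonneg_left hAint (by norm_num))
          (mul_le_mul_of_nonneg_left hBint (by norm_num))

/-- Lemma 5 (second bound): for `α > 48` and all `s ≤ √(d log d / 2)`,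
`E_θ (L̂'_s - L)² ≤ c Φ^L(σ, s)` uniformly over `Θ_s`. -/
theorem second_moment_LhatS' :
    ∀ α : ℝ, 48 < α → ∃ c : ℝ, 0 < c ∧ ∃ d0 : ℕ, 3 ≤ d0 ∧
      ∀ d : ℕ, d0 ≤ d → ∀ σ : ℝ, 0 < σ →
        ∀ s : ℕ, 1 ≤ s → (s : ℝ) ≤ Real.sqrt ((d : ℝ) * Real.log d / 2) →
          ∀ θ ∈ Theta d s,
            ∫⁻ y, ENNReal.ofReal ((LhatS' d α s y - Lfun d θ) ^ 2) ∂(gaussMeasure d θ σ)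
              ≤ ENNReal.ofReal (c * PhiL d σ s) := by
  intro α hα
  refine ⟨324 * α + 96, by linarith, 10000, by norm_num, ?_⟩
  intro d hd σ hσ s hs1 hs θ hθ
  have hdR : (10000 : ℝ) ≤ d := by exact_mod_cast hd
  have hsR : (1 : ℝ) ≤ s := by exact_mod_cast hs1
  have hlog1 : 1 ≤ Real.log d := by
    rw [Real.le_log_iff_exp_le (by linarith)]
    linarith [Real.exp_one_lt_d9]
  have hlog2 : Real.log d ≤ d / 50 := by
    have h1 : Real.log d = 2 * Real.log (√(d : ℝ)) := by
      rw [Real.log_sqrt (by linarith)]; ring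
    have hsq : √(d : ℝ) * √(d : ℝ) = d := Real.mul_self_sqrt (by linarith)
    have h100 : 100 ≤ √(d : ℝ) := Real.le_sqrt_of_sq_le (by linarith)
    have h2 := Real.log_le_self (Real.sqrt_nonneg (d : ℝ))
    nlinarith
  have hs2 : (s : ℝ) ^ 2 ≤ d * Real.log d / 2 := by
    rw [← Real.le_sqrt' (by linarith)]; exact hs
  have hsd : (s : ℝ) ≤ d / 10 := by
    refine abs_le_of_sq_le_sq' ?_ (by linarith) |>.2
    nlinarith
  set l := Real.log (1 + (d : ℝ) * Real.log d / (s : ℝ) ^ 2) with hl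
  have hratio : 2 ≤ (d : ℝ) * Real.log d / (s : ℝ) ^ 2 := by
    rw [le_div_iff₀ (by positivity)]; linarith
  have hl1 : 1 ≤ l := by
    rw [hl, Real.le_log_iff_exp_le (by linarith)]
    linarith [Real.exp_one_lt_d9]
  have hexp : d * Real.exp (-l) ≤ (s : ℝ) ^ 2 := by
    rw [Real.exp_neg, hl, Real.exp_log (by linarith), ← div_eq_mul_inv,
      div_le_iff₀ (by linarith), mul_add, mul_div_cancel₀ _ (by positivity)]
    nlinarith [sq_nonneg (s : ℝ)]
  have hexp2 : d * (Real.exp 1 * Real.exp (-(d : ℝ) / 10)) ≤ 30 := by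
    have h1 := Real.add_one_le_exp ((d : ℝ) / 10)
    have h2 : d * Real.exp (-(d : ℝ) / 10) ≤ 10 := by
      rw [neg_div, Real.exp_neg, ← div_eq_mul_inv, div_le_iff₀ (Real.exp_pos _)]
      linarith
    have h3 := Real.exp_one_lt_d9
    have h4 : 0 ≤ d * Real.exp (-(d : ℝ) / 10) := by positivity
    nlinarith [Real.exp_pos 1]
  classical
  set S : Finset (Fin d) := Finset.univ.filter fun j => θ j ≠ 0 with hSdef
  have hScard : S.card ≤ s := by
    have h1 : {j | θ j ≠ 0}.ncard ≤ s := hθ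
    rw [Set.ncard_eq_toFinset_card'] at h1
    convert h1 using 2
    ext j
    simp [hSdef]
  have hS : ∀ i, i ∉ S → θ i = 0 := by
    intro i hi
    simpa [hSdef] using hi
  have hScR : (S.card : ℝ) ≤ s := by exact_mod_cast hScard
  have hmain := main_bound d θ σ α l s hσ hα (by linarith) S (by omega) hScard
    (hScR.trans hsd) hS
  have hL : ∀ y, LhatS' d α s y = ∑ j, trunc d α l j y := by
    intro y
    unfold LhatS' trunc
    rw [if_pos hs]
  simp only [hL]
  refine hmain.trans (ENNReal.ofReal_le_ofReal ?_)
  unfold PhiL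
  rw [← hl]
  have hσ2 : 0 < σ ^ 2 := by positivity
  have hs21 : 1 ≤ (s : ℝ) ^ 2 := by nlinarith
  have hsl : (s : ℝ) ^ 2 ≤ s ^ 2 * l := by nlinarith
  have key : 2 * ((s : ℝ) ^ 2 * (2 + 162 * α * l)) +
        2 * (16 * (d * Real.exp (-l)) + d * (Real.exp 1 * Real.exp (-(d : ℝ) / 10)))
        ≤ (324 * α + 96) * (s ^ 2 * l) := by
    nlinarith
  have := mul_le_mul_of_nonneg_left key hσ2.le
  linarith
end

section
/- For all integers d ≥ 6, all σ > 0, all real a ∈ [1/4, 1/2), and all integers s with d^a ≤ s ≤ d: inf over estimators T̂ (measurable functions of y) of [ E_0[(T̂(y) − L(0))²] · σ^{−2} d^{−3a + 1/2} + sup_{θ ∈ Θ_s} E_θ[(T̂(y) − L(θ))²] / Φ^L(σ,s) ] ≥ (1/2 − a)/40. -/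
open MeasureTheory ProbabilityTheory

lemma lintegral_pi_prod {d : ℕ} (μ : Fin d → Measure ℝ) [∀ i, IsProbabilityMeasure (μ i)]
    (f : Fin d → ℝ → ENNReal) (hf : ∀ i, Measurable (f i)) :
    ∫⁻ y, ∏ i, f i (y i) ∂(Measure.pi μ) = ∏ i, ∫⁻ x, f i x ∂(μ i) := by
  rw [lintegral_prod_eq_prod_lintegral_of_indepFun Finset.univ (fun i (y : Fin d → ℝ) => f i (y i))
    (iIndepFun_pi (fun i => (hf i).aemeasurable))
    (fun i => (hf i).comp (measurable_pi_apply i))]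
  refine Finset.prod_congr rfl fun i _ => ?_
  exact (measurePreserving_eval μ i).lintegral_comp (hf i)

lemma pi_withDensity_prod {d : ℕ} (μ : Fin d → Measure ℝ) [∀ i, IsProbabilityMeasure (μ i)]
    (f : Fin d → ℝ → ENNReal) (hf : ∀ i, Measurable (f i))
    [∀ i, SigmaFinite ((μ i).withDensity (f i))] :
    Measure.pi (fun i => (μ i).withDensity (f i)) =
      (Measure.pi μ).withDensity (fun y => ∏ i, f i (y i)) := by
  refine Measure.pi_eq fun s hs => ?_
  rw [withDensity_apply _ (MeasurableSet.univ_pi hs),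
    ← lintegral_indicator (MeasurableSet.univ_pi hs)]
  have h1 : ∀ y : Fin d → ℝ, (Set.univ.pi s).indicator (fun y => ∏ i, f i (y i)) y =
      ∏ i, (s i).indicator (f i) (y i) := by
    intro y
    by_cases hy : y ∈ Set.univ.pi s
    · rw [Set.indicator_of_mem hy]
      refine Finset.prod_congr rfl fun i _ => ?_
      rw [Set.indicator_of_mem (hy i (Set.mem_univ i))]
    · rw [Set.indicator_of_notMem hy]
      simp only [Set.mem_pi, Set.mem_univ, true_implies, not_forall] at hy
      obtain ⟨i, hi⟩ := hy
      rw [Finset.prod_eq_zero (Finset.mem_univ i)]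
      rw [Set.indicator_of_notMem hi]
  simp_rw [h1]
  rw [lintegral_pi_prod μ (fun i => (s i).indicator (f i)) (fun i => (hf i).indicator (hs i))]
  refine Finset.prod_congr rfl fun i _ => ?_
  rw [lintegral_indicator (hs i), withDensity_apply _ (hs i)]

lemma gaussianReal_shift (t σ : ℝ) (hσ : 0 < σ) :
    gaussianReal t (Real.toNNReal (σ ^ 2)) =
      (gaussianReal 0 (Real.toNNReal (σ ^ 2))).withDensity
        (fun x => ENNReal.ofReal (Real.exp ((t * x - t ^ 2 / 2) / σ ^ 2))) := by
  have hv : Real.toNNReal (σ ^ 2) ≠ 0 := by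
    have : 0 < σ ^ 2 := by positivity
    simpa using hσ.ne'
  have hc : ((Real.toNNReal (σ ^ 2) : NNReal) : ℝ) = σ ^ 2 := Real.coe_toNNReal _ (sq_nonneg σ)
  rw [gaussianReal_of_var_ne_zero _ hv, gaussianReal_of_var_ne_zero _ hv,
    ← withDensity_mul _ (measurable_gaussianPDF _ _) (by fun_prop)]
  congr 1
  ext x
  simp only [Pi.mul_apply, gaussianPDF, gaussianPDFReal, hc]
  rw [← ENNReal.ofReal_mul (by positivity), mul_assoc (√_)⁻¹, ← Real.exp_add]
  congr 3
  field_simp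
  ring

noncomputable def lik (d : ℕ) (θ : Fin d → ℝ) (σ : ℝ) (y : Fin d → ℝ) : ℝ :=
  Real.exp (∑ j, (θ j * y j - θ j ^ 2 / 2) / σ ^ 2)

lemma measurable_lik (d : ℕ) (θ : Fin d → ℝ) (σ : ℝ) : Measurable (lik d θ σ) := by
  unfold lik
  fun_prop

instance instProbGaussMeasure (d : ℕ) (θ : Fin d → ℝ) (σ : ℝ) :
    IsProbabilityMeasure (gaussMeasure d θ σ) := by
  unfold gaussMeasure; infer_instance

lemma gaussMeasure_eq (d : ℕ) (θ : Fin d → ℝ) (σ : ℝ) (hσ : 0 < σ) :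
    gaussMeasure d θ σ =
      (gaussMeasure d 0 σ).withDensity (fun y => ENNReal.ofReal (lik d θ σ y)) := by
  have key := fun j => gaussianReal_shift (θ j) σ hσ
  have : ∀ j, SigmaFinite ((gaussianReal 0 (Real.toNNReal (σ ^ 2))).withDensity
        (fun x => ENNReal.ofReal (Real.exp ((θ j * x - θ j ^ 2 / 2) / σ ^ 2)))) := by
    intro j
    rw [← key j]; infer_instance
  have h := pi_withDensity_prod (fun _ : Fin d => gaussianReal 0 (Real.toNNReal (σ ^ 2)))
    (fun j x => ENNReal.ofReal (Real.exp ((θ j * x - θ j ^ 2 / 2) / σ ^ 2)))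
    (fun j => by fun_prop)
  unfold gaussMeasure
  simp_rw [key]
  rw [h]
  congr 1
  ext y
  rw [lik, Real.exp_sum, ENNReal.ofReal_prod_of_nonneg (fun _ _ => (Real.exp_pos _).le)]

lemma lintegral_lik (d : ℕ) (θ : Fin d → ℝ) (σ : ℝ) (hσ : 0 < σ) :
    ∫⁻ y, ENNReal.ofReal (lik d θ σ y) ∂(gaussMeasure d 0 σ) = 1 := by
  have h : gaussMeasure d θ σ Set.univ = 1 := measure_univ
  rw [gaussMeasure_eq d θ σ hσ, withDensity_apply _ MeasurableSet.univ] at h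
  simpa using h

lemma lintegral_lik_mul (d : ℕ) (θ η : Fin d → ℝ) (σ : ℝ) (hσ : 0 < σ) :
    ∫⁻ y, ENNReal.ofReal (lik d θ σ y * lik d η σ y) ∂(gaussMeasure d 0 σ) =
      ENNReal.ofReal (Real.exp ((∑ j, θ j * η j) / σ ^ 2)) := by
  have h : ∀ y, lik d θ σ y * lik d η σ y =
      Real.exp ((∑ j, θ j * η j) / σ ^ 2) * lik d (θ + η) σ y := by
    intro y
    simp only [lik, ← Real.exp_add, Finset.sum_div, ← Finset.sum_add_distrib, Pi.add_apply]
    congr 1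
    refine Finset.sum_congr rfl fun j _ => ?_
    ring
  simp_rw [h, ENNReal.ofReal_mul (Real.exp_pos _).le]
  rw [lintegral_const_mul _ (measurable_lik _ _ _).ennreal_ofReal, lintegral_lik d _ σ hσ, mul_one]

lemma pointwise_ineq (A B L t q : ℝ) (hA : 0 < A) (hB : 0 < B) (hq : 0 ≤ q) :
    5 / 9 * (L ^ 2 * B) * q ≤
      t ^ 2 * A + (t - L) ^ 2 * q * B + L ^ 2 * B ^ 2 / (9 * A) * q ^ 2 := by
  have e : t ^ 2 * A + (t - L) ^ 2 * q * B + L ^ 2 * B ^ 2 / (9 * A) * q ^ 2 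
      - 5 / 9 * (L ^ 2 * B) * q = 
      (A + B * q) * (t - L * (B * q) / (A + B * q)) ^ 2
      + L ^ 2 * (B * q) * (2 * A - B * q) ^ 2 / (9 * A * (A + B * q)) := by
    have : A + B * q ≠ 0 := by positivity
    field_simp
    ring
  have : 0 ≤ (A + B * q) * (t - L * (B * q) / (A + B * q)) ^ 2
      + L ^ 2 * (B * q) * (2 * A - B * q) ^ 2 / (9 * A * (A + B * q)) := by positivity
  linarith

lemma key_bound {Ω ι : Type*} [MeasurableSpace Ω] (μ : Measure Ω) [Fintype ι] [Nonempty ι]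
    (l : ι → Ω → ℝ) (hl : ∀ i, Measurable (l i)) (hl0 : ∀ i y, 0 ≤ l i y)
    (hl1 : ∀ i, ∫⁻ y, ENNReal.ofReal (l i y) ∂μ = 1)
    (X : ℝ) (hX0 : 0 ≤ X)
    (hX : ∀ i, ∑ k, ∫⁻ y, ENNReal.ofReal (l i y * l k y) ∂μ ≤
      ENNReal.ofReal (Fintype.card ι * X))
    (T : Ω → ℝ) (hT : Measurable T) (L A B : ℝ) (hA : 0 < A) (hB : 0 < B) (hBX : B * X ≤ 2 * A)
    (R : ENNReal)
    (hR : ∀ i, ∫⁻ y, ENNReal.ofReal ((T y - L) ^ 2)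
      ∂(μ.withDensity (fun y => ENNReal.ofReal (l i y))) ≤ R) :
    ENNReal.ofReal (L ^ 2 * B / 3) ≤
      (∫⁻ y, ENNReal.ofReal (T y ^ 2) ∂μ) * ENNReal.ofReal A + R * ENNReal.ofReal B := by
  set N : ℝ := (Fintype.card ι : ℝ) with hN
  have hN0 : 0 < N := by rw [hN]; exact_mod_cast Fintype.card_pos
  set q : Ω → ℝ := fun y => N⁻¹ * ∑ i, l i y with hq
  have hqm : Measurable q := by
    rw [hq]; exact (Finset.measurable_sum _ fun i _ => hl i).const_mul _
  have hq0 : ∀ y, 0 ≤ q y := fun y =>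
    mul_nonneg (inv_nonneg.2 hN0.le) (Finset.sum_nonneg fun i _ => hl0 i y)
  have hNc : ENNReal.ofReal N⁻¹ * (Fintype.card ι : ENNReal) = 1 := by
    rw [← ENNReal.ofReal_natCast, ← ENNReal.ofReal_mul (inv_nonneg.2 hN0.le), ← hN,
      inv_mul_cancel₀ hN0.ne', ENNReal.ofReal_one]
  -- first moment
  have h1 : ∫⁻ y, ENNReal.ofReal (q y) ∂μ = 1 := by
    simp_rw [hq, ENNReal.ofReal_mul (inv_nonneg.2 hN0.le),
      ENNReal.ofReal_sum_of_nonneg (fun i _ => hl0 i _)]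
    rw [lintegral_const_mul _ (Finset.measurable_sum _ fun i _ => (hl i).ennreal_ofReal),
      lintegral_finsetSum _ (fun i _ => (hl i).ennreal_ofReal)]
    simp only [hl1, Finset.sum_const, Finset.card_univ, nsmul_eq_mul, mul_one]
    exact hNc
  -- second moment
  have h2 : ∫⁻ y, ENNReal.ofReal (q y ^ 2) ∂μ ≤ ENNReal.ofReal X := by
    have e : ∀ y, q y ^ 2 = N⁻¹ * N⁻¹ * ∑ i, ∑ k, l i y * l k y := by
      intro y
      rw [hq, ← Finset.sum_mul_sum]; ring
    have hNN : 0 ≤ N⁻¹ * N⁻¹ := by positivity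
    simp_rw [e, ENNReal.ofReal_mul hNN,
      ENNReal.ofReal_sum_of_nonneg (fun i _ => Finset.sum_nonneg fun k _ =>
        mul_nonneg (hl0 i _) (hl0 k _)),
      ENNReal.ofReal_sum_of_nonneg (fun k _ => mul_nonneg (hl0 _ _) (hl0 k _))]
    have hm : ∀ i k, Measurable fun y => ENNReal.ofReal (l i y * l k y) :=
      fun i k => ((hl i).mul (hl k)).ennreal_ofReal
    rw [lintegral_const_mul _ (Finset.measurable_sum _ fun i _ =>
        Finset.measurable_sum _ fun k _ => hm i k),
      lintegral_finsetSum _ (fun i _ => Finset.measurable_sum _ fun k _ => hm i k)]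
    simp_rw [lintegral_finsetSum _ (fun k _ => hm _ k)]
    calc _ ≤ ENNReal.ofReal (N⁻¹ * N⁻¹) * ∑ i : ι, ENNReal.ofReal (N * X) := by
            gcongr with i _; exact hX i
      _ = ENNReal.ofReal X := by
        rw [Finset.sum_const, Finset.card_univ, nsmul_eq_mul, ← ENNReal.ofReal_natCast,
          ← ENNReal.ofReal_mul (by positivity), ← ENNReal.ofReal_mul hNN, ← hN]
        congr 1
        field_simp
  -- risk
  have h3 : ∫⁻ y, ENNReal.ofReal ((T y - L) ^ 2 * q y) ∂μ ≤ R := by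
    have e : ∀ y, (T y - L) ^ 2 * q y = N⁻¹ * ∑ i, l i y * (T y - L) ^ 2 := by
      intro y
      rw [hq, ← Finset.sum_mul]; ring
    have hm : ∀ i, Measurable fun y => ENNReal.ofReal (l i y * (T y - L) ^ 2) :=
      fun i => ((hl i).mul ((hT.sub_const L).pow_const 2)).ennreal_ofReal
    simp_rw [e, ENNReal.ofReal_mul (inv_nonneg.2 hN0.le),
      ENNReal.ofReal_sum_of_nonneg (fun i _ => mul_nonneg (hl0 i _) (sq_nonneg _))]
    rw [lintegral_const_mul _ (Finset.measurable_sum _ fun i _ => hm i),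
      lintegral_finsetSum _ (fun i _ => hm i)]
    calc _ ≤ ENNReal.ofReal N⁻¹ * ∑ i : ι, R := by
            gcongr with i _
            refine le_trans (le_of_eq ?_) (hR i)
            rw [lintegral_withDensity_eq_lintegral_mul _ (hl i).ennreal_ofReal
              ((hT.sub_const L).pow_const 2).ennreal_ofReal]
            simp_rw [Pi.mul_apply, ENNReal.ofReal_mul (hl0 i _)]
      _ = R := by
        rw [Finset.sum_const, Finset.card_univ, nsmul_eq_mul, ← mul_assoc, hNc, one_mul]
  have hC : 0 ≤ 5 / 9 * (L ^ 2 * B) := by positivity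
  have hD : 0 ≤ L ^ 2 * B ^ 2 / (9 * A) := by positivity
  have h4 : ENNReal.ofReal (5 / 9 * (L ^ 2 * B)) ≤
      (∫⁻ y, ENNReal.ofReal (T y ^ 2) ∂μ) * ENNReal.ofReal A + R * ENNReal.ofReal B +
        ENNReal.ofReal (2 / 9 * (L ^ 2 * B)) := by
    calc ENNReal.ofReal (5 / 9 * (L ^ 2 * B))
        = ∫⁻ y, ENNReal.ofReal (5 / 9 * (L ^ 2 * B) * q y) ∂μ := by
          simp_rw [ENNReal.ofReal_mul hC]
          rw [lintegral_const_mul _ hqm.ennreal_ofReal, h1, mul_one]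
      _ ≤ ∫⁻ y, (ENNReal.ofReal (T y ^ 2) * ENNReal.ofReal A +
            ENNReal.ofReal ((T y - L) ^ 2 * q y) * ENNReal.ofReal B +
            ENNReal.ofReal (L ^ 2 * B ^ 2 / (9 * A)) * ENNReal.ofReal (q y ^ 2)) ∂μ := by
          refine lintegral_mono fun y => ?_
          have hy := hq0 y
          simp only
          rw [← ENNReal.ofReal_mul (sq_nonneg _), ← ENNReal.ofReal_mul (by positivity),
            ← ENNReal.ofReal_mul hD, ← ENNReal.ofReal_add (by positivity) (by positivity),
            ← ENNReal.ofReal_add (by positivity) (by positivity)]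
          exact ENNReal.ofReal_le_ofReal (pointwise_ineq A B L (T y) (q y) hA hB hy)
      _ = (∫⁻ y, ENNReal.ofReal (T y ^ 2) ∂μ) * ENNReal.ofReal A +
            (∫⁻ y, ENNReal.ofReal ((T y - L) ^ 2 * q y) ∂μ) * ENNReal.ofReal B +
            ENNReal.ofReal (L ^ 2 * B ^ 2 / (9 * A)) * ∫⁻ y, ENNReal.ofReal (q y ^ 2) ∂μ := by
          rw [lintegral_add_left (by fun_prop), lintegral_add_left (by fun_prop),
            lintegral_mul_const _ (by fun_prop), lintegral_mul_const _ (by fun_prop),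
            lintegral_const_mul _ (by fun_prop)]
      _ ≤ (∫⁻ y, ENNReal.ofReal (T y ^ 2) ∂μ) * ENNReal.ofReal A + R * ENNReal.ofReal B +
            ENNReal.ofReal (L ^ 2 * B ^ 2 / (9 * A)) * ENNReal.ofReal X := by
          gcongr
      _ ≤ _ := by
          gcongr
          rw [← ENNReal.ofReal_mul hD]
          refine ENNReal.ofReal_le_ofReal ?_
          rw [div_mul_eq_mul_div, div_le_iff₀ (by positivity)]
          have := mul_le_mul_of_nonneg_left hBX (show 0 ≤ L ^ 2 * B by positivity)
          nlinarith
  have h5 : ENNReal.ofReal (5 / 9 * (L ^ 2 * B)) =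
      ENNReal.ofReal (L ^ 2 * B / 3) + ENNReal.ofReal (2 / 9 * (L ^ 2 * B)) := by
    rw [← ENNReal.ofReal_add (by positivity) (by positivity)]
    congr 1; ring
  rw [h5] at h4
  exact (ENNReal.add_le_add_iff_right ENNReal.ofReal_ne_top).1 h4

noncomputable def blockVec {d s m : ℕ} (e : Fin s × Fin m → Fin d) (b : ℝ) (f : Fin s → Fin m) :
    Fin d → ℝ := fun j => ∑ i, if j = e (i, f i) then b else 0

lemma blockVec_mem {d s m : ℕ} (e : Fin s × Fin m → Fin d) (b : ℝ) (f : Fin s → Fin m) :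
    blockVec e b f ∈ Theta d s := by
  have hsub : {j | blockVec e b f j ≠ 0} ⊆ Set.range (fun i => e (i, f i)) := by
    intro j hj
    by_contra hn
    apply hj
    unfold blockVec
    refine Finset.sum_eq_zero fun i _ => ?_
    rw [if_neg]
    rintro rfl
    exact hn ⟨i, rfl⟩
  refine (Set.ncard_le_ncard hsub (Set.toFinite _)).trans ?_
  rw [← Set.image_univ]
  refine (Set.ncard_image_le (Set.toFinite _)).trans ?_
  simp [Set.ncard_univ]

lemma blockVec_L {d s m : ℕ} (e : Fin s × Fin m → Fin d) (b : ℝ) (f : Fin s → Fin m) :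
    Lfun d (blockVec e b f) = s * b := by
  unfold Lfun blockVec
  rw [Finset.sum_comm]
  simp

lemma blockVec_inner {d s m : ℕ} (e : Fin s × Fin m → Fin d) (he : Function.Injective e) (b : ℝ)
    (f g : Fin s → Fin m) :
    ∑ j, blockVec e b f j * blockVec e b g j = ∑ i, if f i = g i then b ^ 2 else 0 := by
  have h : ∀ j, blockVec e b f j * blockVec e b g j =
      ∑ i, if j = e (i, f i) then b * blockVec e b g j else 0 := by
    intro j
    conv_lhs => rw [blockVec, Finset.sum_mul]
    refine Finset.sum_congr rfl fun i _ => ?_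
    split_ifs <;> simp
  simp_rw [h]
  rw [Finset.sum_comm]
  refine Finset.sum_congr rfl fun i _ => ?_
  rw [Finset.sum_ite_eq' Finset.univ (e (i, f i)) (fun j => b * blockVec e b g j)]
  simp only [Finset.mem_univ, if_true, blockVec]
  rw [Finset.sum_eq_single i]
  · by_cases hfg : f i = g i
    · simp [hfg, sq]
    · rw [if_neg hfg, if_neg, mul_zero]
      intro h'
      exact hfg (Prod.ext_iff.1 (he h')).2
  · intro k _ hk
    rw [if_neg]
    intro h'
    exact hk (Prod.ext_iff.1 (he h')).1.symm
  · simp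

lemma sum_exp_block {s m : ℕ} (u : ℝ) (f : Fin s → Fin m) :
    ∑ g : Fin s → Fin m, Real.exp (∑ i, if f i = g i then u else 0) =
      ((m : ℝ) + (Real.exp u - 1)) ^ s := by
  simp_rw [Real.exp_sum]
  have h := Finset.prod_univ_sum (fun _ : Fin s => (Finset.univ : Finset (Fin m)))
    (fun i k => Real.exp (if f i = k then u else 0))
  rw [Fintype.piFinset_univ] at h
  rw [← h]
  have h2 : ∀ i, ∑ k, Real.exp (if f i = k then u else 0) = (m : ℝ) + (Real.exp u - 1) := by
    intro i
    have : ∀ k, Real.exp (if f i = k then u else 0) = 1 + if f i = k then (Real.exp u - 1) else 0 := by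
      intro k; split_ifs <;> simp
    simp_rw [this, Finset.sum_add_distrib]
    simp
  simp [h2]

lemma moment_bound (d s m : ℕ) (hs : 0 < s) (hm : 0 < m) (hd : 1 ≤ d) (hdm : d ≤ 2 * (s * m))
    (c : ℝ) (hc0 : 0 ≤ c) (hc1 : c ≤ 1) :
    ((m : ℝ) + (Real.exp (c * Real.log (1 + (d : ℝ) * Real.log d / (s : ℝ) ^ 2)) - 1)) ^ s ≤
      (m : ℝ) ^ s * (d : ℝ) ^ (2 * c) := by
  have hs' : (0 : ℝ) < s := by exact_mod_cast hs
  have hm' : (0 : ℝ) < m := by exact_mod_cast hm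
  have hd' : (1 : ℝ) ≤ d := by exact_mod_cast hd
  have hlog : 0 ≤ Real.log d := Real.log_nonneg hd'
  have hdm' : (d : ℝ) ≤ 2 * (s * m) := by exact_mod_cast hdm
  set x := (d : ℝ) * Real.log d / (s : ℝ) ^ 2 with hx
  have hx0 : 0 ≤ x := by positivity
  have hE : Real.exp (c * Real.log (1 + x)) ≤ 1 + c * x := by
    rw [mul_comm, ← Real.rpow_def_of_pos (by linarith)]
    exact rpow_one_add_le_one_add_mul_self (by linarith) hc0 hc1
  have hE1 : 1 ≤ Real.exp (c * Real.log (1 + x)) :=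
    Real.one_le_exp (mul_nonneg hc0 (Real.log_nonneg (by linarith)))
  have h1 : (m : ℝ) + (Real.exp (c * Real.log (1 + x)) - 1) ≤ m * Real.exp (c * x / m) := by
    have h2 : c * x / m + 1 ≤ Real.exp (c * x / m) := Real.add_one_le_exp _
    have h3 := mul_le_mul_of_nonneg_left h2 hm'.le
    have h4 : (m : ℝ) * (c * x / m + 1) = c * x + m := by field_simp
    linarith
  calc _ ≤ ((m : ℝ) * Real.exp (c * x / m)) ^ s := by
        apply pow_le_pow_left₀ (by linarith) h1
    _ = (m : ℝ) ^ s * Real.exp (s * (c * x / m)) := by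
        rw [mul_pow, ← Real.exp_nat_mul]
    _ ≤ _ := by
        gcongr
        rw [Real.rpow_def_of_pos (by linarith)]
        apply Real.exp_le_exp.2
        have : (s : ℝ) * (c * x / m) = c * Real.log d * (d / (s * m)) := by
          rw [hx]; field_simp
        rw [this]
        have h5 : (d : ℝ) / (s * m) ≤ 2 := by
          rw [div_le_iff₀ (by positivity)]; exact hdm'
        have := mul_le_mul_of_nonneg_left h5 (mul_nonneg hc0 hlog)
        linarith

lemma phi_lower (d s : ℕ) (hd : 6 ≤ d) (a : ℝ) (ha : a < 1 / 2)
    (hs : (d : ℝ) ^ a ≤ (s : ℝ)) :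
    (d : ℝ) ^ (2 * a) / 2 ≤
      (s : ℝ) ^ 2 * Real.log (1 + (d : ℝ) * Real.log d / (s : ℝ) ^ 2) := by
  have hd' : (6 : ℝ) ≤ d := by exact_mod_cast hd
  have hlog : 1 ≤ Real.log d := by
    rw [Real.le_log_iff_exp_le (by linarith)]
    linarith [Real.exp_one_lt_d9]
  have hp : 0 < (d : ℝ) ^ a := Real.rpow_pos_of_pos (by linarith) _
  have hs' : (0 : ℝ) < s := hp.trans_le hs
  have e1 : (d : ℝ) ^ (2 * a) = ((d : ℝ) ^ a) ^ 2 := by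
    rw [mul_comm, Real.rpow_mul (by linarith)]; norm_num
  have hx0s : (d : ℝ) ^ (2 * a) ≤ (s : ℝ) ^ 2 := by
    rw [e1]; gcongr
  have hx0d : (d : ℝ) ^ (2 * a) ≤ d := by
    calc (d : ℝ) ^ (2 * a) ≤ (d : ℝ) ^ (1 : ℝ) :=
          Real.rpow_le_rpow_of_exponent_le (by linarith) (by linarith)
      _ = d := Real.rpow_one _
  have hx0 : 0 < (d : ℝ) ^ (2 * a) := Real.rpow_pos_of_pos (by linarith) _
  set x0 := (d : ℝ) ^ (2 * a)
  set D := (d : ℝ) * Real.log d with hD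
  have hDd : x0 ≤ D := by nlinarith
  set x := (s : ℝ) ^ 2
  have hx : 0 < x := by linarith
  have hl : 1 - (1 + D / x)⁻¹ ≤ Real.log (1 + D / x) :=
    Real.one_sub_inv_le_log_of_pos (by positivity)
  refine le_trans ?_ (mul_le_mul_of_nonneg_left hl hx.le)
  have : x * (1 - (1 + D / x)⁻¹) = x * D / (x + D) := by
    have : x + D ≠ 0 := by positivity
    field_simp
    ring
  rw [this, div_le_div_iff₀ (by positivity) (by positivity)]
  nlinarith

/-- Lemma 6: for `d ≥ 6`, `a ∈ [1/4, 1/2)` and `s ≥ d^a`, every estimator `T̂` satisfies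
`E₀(T̂ - L)² σ⁻² d^{-3a+1/2} + sup_{θ ∈ Θ_s} E_θ(T̂ - L)² / Φ^L(σ, s) ≥ (1/2 - a)/40`. -/
theorem two_point_risk_lower_bound :
    ∀ d : ℕ, 6 ≤ d → ∀ σ : ℝ, 0 < σ → ∀ a : ℝ, 1 / 4 ≤ a → a < 1 / 2 →
      ∀ s : ℕ, (d : ℝ) ^ a ≤ (s : ℝ) → s ≤ d →
        ∀ T : (Fin d → ℝ) → ℝ, Measurable T →
          ENNReal.ofReal ((1 / 2 - a) / 40) ≤
            (∫⁻ y, ENNReal.ofReal ((T y - Lfun d 0) ^ 2) ∂(gaussMeasure d 0 σ)) *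
                ENNReal.ofReal ((σ ^ 2)⁻¹ * (d : ℝ) ^ (-3 * a + 1 / 2)) +
              (⨆ θ ∈ Theta d s,
                  ∫⁻ y, ENNReal.ofReal ((T y - Lfun d θ) ^ 2) ∂(gaussMeasure d θ σ)) /
                ENNReal.ofReal (PhiL d σ s) := by
  intro d hd σ hσ a ha1 ha2 s hs hsd T hT
  have hd' : (6 : ℝ) ≤ d := by exact_mod_cast hd
  have hd0 : (0 : ℝ) < d := by linarith
  have hs' : (0 : ℝ) < s := (Real.rpow_pos_of_pos hd0 _).trans_le hs
  have hs0 : 0 < s := by exact_mod_cast hs'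
  obtain ⟨m, hm⟩ : ∃ m, m = d / s := ⟨_, rfl⟩
  have hm0 : 0 < m := by rw [hm]; exact Nat.div_pos hsd hs0
  have hsm : s * m ≤ d := by rw [hm]; exact Nat.mul_div_le d s
  have hdm : d ≤ 2 * (s * m) := by
    have h1 : d < s * (d / s + 1) := by
      have := Nat.lt_mul_div_succ d hs0
      simpa using this
    rw [← hm] at h1
    nlinarith
  have : Nonempty (Fin m) := ⟨⟨0, hm0⟩⟩
  have he : Function.Injective (fun p : Fin s × Fin m => Fin.castLE hsm (finProdFinEquiv p)) :=
    (Fin.castLE_injective hsm).comp finProdFinEquiv.injective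
  set e : Fin s × Fin m → Fin d := fun p => Fin.castLE hsm (finProdFinEquiv p) with he_def
  have hphi := phi_lower d s hd a ha2 hs
  set lg := Real.log (1 + (d : ℝ) * Real.log d / (s : ℝ) ^ 2) with hlg
  have hx0 : 0 < (d : ℝ) ^ (2 * a) := Real.rpow_pos_of_pos hd0 _
  have hlg0 : 0 < lg := by
    have h1 : 0 < (s : ℝ) ^ 2 * lg := by linarith
    exact (pos_iff_pos_of_mul_pos h1).1 (by positivity)
  have hPhi : PhiL d σ s = σ ^ 2 * (s : ℝ) ^ 2 * lg := rfl
  have hPhi0 : 0 < PhiL d σ s := by rw [hPhi]; positivity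
  set c := (1 / 2 - a) / 2 with hc
  have hc0 : 0 < c := by rw [hc]; linarith
  set b := σ * √(c * lg) with hb
  have hb2 : b ^ 2 / σ ^ 2 = c * lg := by
    rw [hb, mul_pow, Real.sq_sqrt (by positivity)]
    field_simp
  have hA : 0 < (σ ^ 2)⁻¹ * (d : ℝ) ^ (-3 * a + 1 / 2) := by positivity
  have key := key_bound (gaussMeasure d 0 σ) (fun f => lik d (blockVec e b f) σ)
    (fun f => measurable_lik _ _ _) (fun f y => (Real.exp_pos _).le)
    (fun f => lintegral_lik d _ σ hσ) ((d : ℝ) ^ (2 * c)) (by positivity)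
    (by
      intro f
      simp_rw [lintegral_lik_mul d _ _ σ hσ]
      rw [← ENNReal.ofReal_sum_of_nonneg (fun _ _ => (Real.exp_pos _).le)]
      refine ENNReal.ofReal_le_ofReal ?_
      have h1 : ∀ g, (∑ j, blockVec e b f j * blockVec e b g j) / σ ^ 2 =
          ∑ i, if f i = g i then c * lg else 0 := by
        intro g
        rw [blockVec_inner e he, Finset.sum_div]
        refine Finset.sum_congr rfl fun i _ => ?_
        split_ifs
        · exact hb2
        · simp
      simp_rw [h1]
      rw [sum_exp_block]
      have h2 := moment_bound d s m hs0 hm0 (by omega) hdm c hc0.le (by rw [hc]; linarith)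
      simpa using h2)
    T hT (s * b) ((σ ^ 2)⁻¹ * (d : ℝ) ^ (-3 * a + 1 / 2)) (PhiL d σ s)⁻¹ hA
    (inv_pos.2 hPhi0)
    (by
      rw [inv_mul_le_iff₀ hPhi0, hPhi]
      have h1 : (d : ℝ) ^ (2 * c) = (d : ℝ) ^ (2 * a) * (d : ℝ) ^ (-3 * a + 1 / 2) := by
        rw [← Real.rpow_add hd0, hc]
        congr 1; ring
      have h2 : σ ^ 2 * (s : ℝ) ^ 2 * lg * (2 * ((σ ^ 2)⁻¹ * (d : ℝ) ^ (-3 * a + 1 / 2))) =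
          2 * ((s : ℝ) ^ 2 * lg) * (d : ℝ) ^ (-3 * a + 1 / 2) := by
        field_simp
      rw [h1, h2]
      gcongr
      linarith)
    (⨆ θ ∈ Theta d s, ∫⁻ y, ENNReal.ofReal ((T y - Lfun d θ) ^ 2) ∂(gaussMeasure d θ σ))
    (by
      intro f
      rw [← gaussMeasure_eq d _ σ hσ, ← blockVec_L e b f]
      exact le_iSup₂ (f := fun θ (_ : θ ∈ Theta d s) =>
        ∫⁻ y, ENNReal.ofReal ((T y - Lfun d θ) ^ 2) ∂(gaussMeasure d θ σ))
        (blockVec e b f) (blockVec_mem e b f))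
  have hL0 : Lfun d 0 = 0 := by simp [Lfun]
  rw [hL0, ENNReal.div_eq_inv_mul, mul_comm (ENNReal.ofReal (PhiL d σ s))⁻¹,
    ← ENNReal.ofReal_inv_of_pos hPhi0]
  simp only [sub_zero]
  refine le_trans (ENNReal.ofReal_le_ofReal ?_) key
  have h3 : ((s : ℝ) * b) ^ 2 * (PhiL d σ s)⁻¹ = c := by
    rw [hPhi, hb, mul_pow, mul_pow, Real.sq_sqrt (by positivity)]
    field_simp
  rw [h3, hc]
  linarith
end
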